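/- arXiv:1610.04700 — 2 statements merged into one kernel-verified Lean document; each statement's English description precedes it below -/
import Mathlib

section
/- The attractor is invariant under the piecewise translation map: F(A) = A, where A = ⋂_{n≥1} F^n(Ω). -/
/-- A set map that is a finite union of images of pieces fixes the intersection of its iterates
on any set it maps into itself. -/
theorem map_iInter_iterate_eq_of_finite_pieces {ι α : Type*} [Finite ι] {Ω : Set α}
    {B : ι → Set α} {f : ι → α → α} (hf : ∀ i, Function.Injective (f i))
    {F : Set α → Set α} (hF : ∀ K, F K = ⋃ i, f i '' (K ∩ B i)) (hFΩ : F Ω ⊆ Ω) :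
    F (⋂ n ≥ 1, F^[n] Ω) = ⋂ n ≥ 1, F^[n] Ω := by
  have hmem (K : Set α) (y : α) : y ∈ F K ↔ ∃ i, ∃ x ∈ K, x ∈ B i ∧ f i x = y := by
    simp [hF, and_assoc]
  have hmono : Monotone F := by
    intro K L hKL y hy
    obtain ⟨i, x, hx, hxB, rfl⟩ := (hmem K y).1 hy
    exact (hmem L _).2 ⟨i, x, hKL hx, hxB, rfl⟩
  have hanti : Antitone fun n => F^[n] Ω := hmono.antitone_iterate_of_map_le hFΩ
  apply Set.Subset.antisymm
  · refine Set.subset_iInter₂ fun n hn => ?_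
    have h : F (⋂ n ≥ 1, F^[n] Ω) ⊆ F^[n + 1] Ω := by
      rw [Function.iterate_succ_apply']
      exact hmono (Set.iInter₂_subset n hn)
    exact h.trans (hanti n.le_succ)
  · intro y hy
    by_contra hcon
    have hexit (i : ι) : ∃ n, ∀ x ∈ B i, f i x = y → x ∉ F^[n] Ω := by
      by_contra! h
      obtain ⟨x, hxB, hxy, -⟩ := h 0
      refine hcon ((hmem _ y).2 ⟨i, x, Set.mem_iInter₂.2 fun n _ => ?_, hxB, hxy⟩)
      obtain ⟨z, -, hzy, hz⟩ := h n
      exact hf i (hzy.trans hxy.symm) ▸ hz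
    choose n hn using hexit
    obtain ⟨N, hN⟩ := Finite.exists_le n
    have hyN : y ∈ F^[N + 1] Ω := Set.mem_iInter₂.1 hy (N + 1) N.succ_pos
    rw [Function.iterate_succ_apply'] at hyN
    obtain ⟨i, x, hx, hxB, hxy⟩ := (hmem _ y).1 hyN
    exact hn i x hxB hxy (hanti (hN i) hx)


/-- The attractor `A = ⋂_{n ≥ 1} F^n(Ω)` is invariant under the piecewise
translation map: `F(A) = A`. -/
theorem stmt_2 (d m : ℕ) (hm : 1 ≤ m)
    (Ω : Set (EuclideanSpace ℝ (Fin d))) (hΩne : Ω.Nonempty) (hΩc : IsCompact Ω)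
    (B : Fin m → Set (EuclideanSpace ℝ (Fin d)))
    (hBc : ∀ i, IsCompact (B i)) (hΩB : Ω = ⋃ i, B i)
    (v : Fin m → EuclideanSpace ℝ (Fin d))
    (F : Set (EuclideanSpace ℝ (Fin d)) → Set (EuclideanSpace ℝ (Fin d)))
    (hF : ∀ K, F K = ⋃ i, (fun x => x + v i) '' (K ∩ B i))
    (hFΩ : F Ω ⊆ Ω) :
    F (⋂ n ≥ 1, F^[n] Ω) = ⋂ n ≥ 1, F^[n] Ω := by
  exact map_iInter_iterate_eq_of_finite_pieces (fun i => add_left_injective (v i)) hF hFΩ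
end

section
/- For every compact subset K ⊆ Ω, the projection of its image under the piecewise translation map equals the rotated projection: π(F(K)) = R(π(K)). -/
/-- With `m = d + 1` branches, assuming `v 1 - v 0, …, v d - v 0` form a basis
of `ℝ^d`, let `L` be the lattice they generate, `π : ℝ^d → ℝ^d ⧸ L` the quotient map and
`R : φ ↦ φ + π (v 0)` the rotation of the torus. Then for every compact `K ⊆ Ω` we have
`π (F K) = R (π K)`. -/
theorem stmt_5 (d : ℕ)
    (Ω : Set (EuclideanSpace ℝ (Fin d))) (hΩne : Ω.Nonempty) (hΩc : IsCompact Ω)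
    (B : Fin (d + 1) → Set (EuclideanSpace ℝ (Fin d)))
    (hBc : ∀ i, IsCompact (B i)) (hΩB : Ω = ⋃ i, B i)
    (v : Fin (d + 1) → EuclideanSpace ℝ (Fin d))
    (F : Set (EuclideanSpace ℝ (Fin d)) → Set (EuclideanSpace ℝ (Fin d)))
    (hF : ∀ K, F K = ⋃ i, (fun x => x + v i) '' (K ∩ B i))
    (hFΩ : F Ω ⊆ Ω)
    -- the vectors `v 1 - v 0, …, v d - v 0` form a basis of `ℝ^d`
    (hindep : LinearIndependent ℝ fun i : Fin d => v i.succ - v 0)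
    (hspan : Submodule.span ℝ (Set.range fun i : Fin d => v i.succ - v 0) = ⊤)
    -- `L` is the lattice (`ℤ`-linear span) generated by these vectors
    (L : Submodule ℤ (EuclideanSpace ℝ (Fin d)))
    (hL : L = Submodule.span ℤ (Set.range fun i : Fin d => v i.succ - v 0))
    (K : Set (EuclideanSpace ℝ (Fin d))) (hKc : IsCompact K) (hKΩ : K ⊆ Ω) :
    (Submodule.Quotient.mk (p := L)) '' (F K)
      = (fun φ => φ + Submodule.Quotient.mk (p := L) (v 0)) ''
          ((Submodule.Quotient.mk (p := L)) '' K) := by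
  have key : ∀ (i : Fin (d + 1)) (x : EuclideanSpace ℝ (Fin d)),
      Submodule.Quotient.mk (p := L) (x + v i)
        = Submodule.Quotient.mk (p := L) x + Submodule.Quotient.mk (p := L) (v 0) := by
    intro i x
    rw [← Submodule.Quotient.mk_add, Submodule.Quotient.eq, add_sub_add_left_eq_sub]
    refine Fin.cases ?_ (fun j => ?_) i
    · rw [sub_self]
      exact L.zero_mem
    · rw [hL]
      exact Submodule.subset_span ⟨j, rfl⟩
  rw [hF]
  ext φ
  constructor
  · rintro ⟨y, hy, rfl⟩
    obtain ⟨i, x, hx, rfl⟩ := Set.mem_iUnion.1 hy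
    exact ⟨_, ⟨x, hx.1, rfl⟩, (key i x).symm⟩
  · rintro ⟨_, ⟨x, hx, rfl⟩, rfl⟩
    have hxΩ := hKΩ hx
    rw [hΩB] at hxΩ
    obtain ⟨i, hi⟩ := Set.mem_iUnion.1 hxΩ
    exact ⟨x + v i, Set.mem_iUnion.2 ⟨i, x, ⟨hx, hi⟩, rfl⟩, key i x⟩
end
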